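/- arXiv:1909.01432 — 5 statements merged into one kernel-verified Lean document; each statement's English description precedes it below -/
import Mathlib

section
/- Let n, k be natural numbers with k ≤ n and c₁, c₂ : Fin n → ℝ. Over all binary vectors y : Fin n → {0,1} satisfying ∑_j y(j) = k, the minimum of ∑_j (c₁(j)·y(j) + c₂(j)·(1 − y(j))) equals ∑_j c₂(j) + ∑_{i < k} d↑(i), where d↑ denotes the values of the differences d(j) = c₁(j) − c₂(j) sorted in nondecreasing order; the minimum is attained by setting y(j) = 1 on a set of k indices with the smallest values of c₁(j) − c₂(j). -/
open Finset

/-- A monotone sequence is split at any index `k` by some real threshold. -/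
theorem Monotone.exists_threshold {n : ℕ} {g : Fin n → ℝ} (hg : Monotone g) (k : ℕ) :
    ∃ t, (∀ i : Fin n, (i : ℕ) < k → g i ≤ t) ∧ ∀ i : Fin n, k ≤ (i : ℕ) → t ≤ g i := by
  rcases lt_or_ge k n with hkn | hnk
  · exact ⟨g ⟨k, hkn⟩, fun i hi => hg (Fin.le_def.2 hi.le), fun i hi => hg (Fin.le_def.2 hi)⟩
  · obtain ⟨t, ht⟩ := (Set.finite_range g).bddAbove
    exact ⟨t, fun i _ => ht ⟨i, rfl⟩, fun i hi => absurd i.isLt (by omega)⟩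

theorem Fin.sum_ite_val_lt {n k : ℕ} (hk : k ≤ n) :
    ∑ i : Fin n, (if (i : ℕ) < k then (1 : ℝ) else 0) = k := by
  simp [Fin.card_filter_val_lt, hk]

/-- Among weights in `[0, 1]` of total mass `k`, a monotone sequence has the smallest weighted
sum when all the mass is on the first `k` indices. -/
theorem Monotone.sum_filter_lt_le_sum_mul {n k : ℕ} (hk : k ≤ n) {g z : Fin n → ℝ}
    (hg : Monotone g) (hz₀ : ∀ i, 0 ≤ z i) (hz₁ : ∀ i, z i ≤ 1) (hz : ∑ i, z i = k) :
    ∑ i ∈ univ.filter (fun i : Fin n => (i : ℕ) < k), g i ≤ ∑ i, g i * z i := by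
  obtain ⟨t, hlo, hhi⟩ := hg.exists_threshold k
  have hpos : 0 ≤ ∑ i : Fin n, (g i - t) * (z i - if (i : ℕ) < k then (1 : ℝ) else 0) := by
    refine sum_nonneg fun i _ => ?_
    split_ifs with hi
    · exact mul_nonneg_of_nonpos_of_nonpos (by linarith [hlo i hi]) (by linarith [hz₁ i])
    · exact mul_nonneg (by linarith [hhi i (not_lt.1 hi)]) (by linarith [hz₀ i])
  simp only [sub_mul, mul_sub, sum_sub_distrib, ← mul_sum, hz, Fin.sum_ite_val_lt hk] at hpos
  simp only [mul_ite, mul_one, mul_zero, ← sum_filter] at hpos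
  linarith

/-- The total damage of `y`, in terms of the differences `c₁ - c₂` reordered by `σ`. -/
theorem sum_damage_eq {n : ℕ} (c₁ c₂ y : Fin n → ℝ) (σ : Equiv.Perm (Fin n)) :
    ∑ j, (c₁ j * y j + c₂ j * (1 - y j)) =
      ∑ j, c₂ j + ∑ i, (c₁ - c₂) (σ i) * y (σ i) := by
  rw [Equiv.sum_comp σ fun j => (c₁ - c₂) j * y j, ← sum_add_distrib]
  refine sum_congr rfl fun j _ => ?_
  rw [Pi.sub_apply]
  ring

/-- Proposition 2 (asymmetric metrics, no protection): over binary `y` with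
`∑ y = k`, the minimum of `∑ (c₁ y + c₂ (1 - y))` equals
`∑ c₂ + (sum of the k smallest values of c₁ - c₂)`, attained by setting `y j = 1`
on a set of `k` indices with the smallest values of `c₁ j - c₂ j`. -/
theorem attacker_asymmetric_best_response (n k : ℕ) (hk : k ≤ n) (c₁ c₂ : Fin n → ℝ) :
    IsLeast {s : ℝ | ∃ y : Fin n → ℝ, (∀ j, y j = 0 ∨ y j = 1) ∧
        (∑ j, y j) = (k : ℝ) ∧
        s = ∑ j, (c₁ j * y j + c₂ j * (1 - y j))}
      (∑ j, c₂ j + ∑ i ∈ Finset.univ.filter (fun i : Fin n => (i : ℕ) < k),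
        (c₁ - c₂) (Tuple.sort (c₁ - c₂) i)) ∧
    ∑ j, (c₁ j * (if ((Tuple.sort (c₁ - c₂)).symm j : ℕ) < k then (1 : ℝ) else 0) +
        c₂ j * (1 - if ((Tuple.sort (c₁ - c₂)).symm j : ℕ) < k then (1 : ℝ) else 0)) =
      ∑ j, c₂ j + ∑ i ∈ Finset.univ.filter (fun i : Fin n => (i : ℕ) < k),
        (c₁ - c₂) (Tuple.sort (c₁ - c₂) i) := by
  set σ := Tuple.sort (c₁ - c₂)
  have hval := sum_damage_eq c₁ c₂ (fun j => if (σ.symm j : ℕ) < k then (1 : ℝ) else 0) σ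
  simp only [Equiv.symm_apply_apply, mul_ite (_ < k) ((c₁ - c₂) _), mul_one, mul_zero,
    ← sum_filter] at hval
  refine ⟨⟨⟨fun j => if (σ.symm j : ℕ) < k then (1 : ℝ) else 0, fun j => ?_, ?_, hval.symm⟩, ?_⟩,
    hval⟩
  · exact (ite_eq_or_eq _ _ _).symm
  · rw [Equiv.sum_comp σ.symm fun i => if (i : ℕ) < k then (1 : ℝ) else 0]
    exact Fin.sum_ite_val_lt hk
  · rintro s ⟨y, hy, hsum, rfl⟩
    rw [sum_damage_eq c₁ c₂ y σ]
    refine add_le_add_right (Monotone.sum_filter_lt_le_sum_mul hk (Tuple.monotone_sort (c₁ - c₂))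
      (z := y ∘ σ) (fun i => ?_) (fun i => ?_) ((Equiv.sum_comp σ y).trans hsum)) _
    · rcases hy (σ i) with h | h <;> simp [h]
    · rcases hy (σ i) with h | h <;> simp [h]
end

section
/- Let n be a natural number, c₁, c₂ : Fin n → ℝ, and for each tuple j let c(j) = min(c₁(j), c₂(j)). Suppose the attacker best-responds per tuple as follows: if both edges of tuple j are protected he deletes neither (damage 0); if exactly one is protected he deletes the other (damage c₂(j) or c₁(j) accordingly); if neither is protected he deletes the one with smaller damage (damage c(j)). Let N_p be the number of tuples j with c(j) > 0 and let k_D be the defender's budget of protected edges among the 2n edges. Then the minimum achievable total damage is ∑_j c(j) minus the sum of the min(⌊k_D/2⌋, N_p) largest positive values of c, and it is achieved by protecting both edges of the min(⌊k_D/2⌋, N_p) tuples with the largest positive weights c(j) (protecting all tuples with positive weight when k_D ≥ 2N_p). -/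
open Finset

/-- Exchange inequality: if `θ ≥ 0` separates the values of `f` on `T` from those outside `T`,
and `θ` vanishes unless `#B ≤ #T`, then `T` has at least the `f`-weight of `B`. -/
lemma sum_le_sum_of_threshold {ι : Type*} [DecidableEq ι] {f : ι → ℝ} {T B : Finset ι} {θ : ℝ}
    (hθ : 0 ≤ θ) (hT : ∀ i ∈ T, θ ≤ f i) (hB : ∀ i ∉ T, f i ≤ θ) (h : θ = 0 ∨ #B ≤ #T) :
    ∑ i ∈ B, f i ≤ ∑ i ∈ T, f i := by
  have hBT : ∑ i ∈ B \ T, f i ≤ #(B \ T) • θ :=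
    sum_le_card_nsmul _ _ _ fun i hi => hB i (mem_sdiff.1 hi).2
  have hTB : #(T \ B) • θ ≤ ∑ i ∈ T \ B, f i :=
    card_nsmul_le_sum _ _ _ fun i hi => hT i (mem_sdiff.1 hi).1
  have hcard : #(B \ T) • θ ≤ #(T \ B) • θ := by
    rcases h with rfl | h
    · simp
    · exact nsmul_le_nsmul_left hθ (card_sdiff_le_card_sdiff_iff.2 h)
  have h₁ := sum_sdiff_sub_sum_sdiff (s₁ := T) (s₂ := B) (f := f)
  linarith

lemma lt_card_filter_pos_iff {n : ℕ} {d : Fin n → ℝ} (hd : Antitone d) (i : Fin n) :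
    (i : ℕ) < #{k | 0 < d k} ↔ 0 < d i := by
  constructor
  · intro h
    by_contra! hi
    have hsub : ({k | 0 < d k} : Finset (Fin n)) ⊆ Iio i := fun k hk => by
      rw [mem_Iio]
      by_contra! hik
      exact absurd (mem_filter.1 hk).2 (not_lt.2 ((hd hik).trans hi))
    have := card_le_card hsub
    rw [Fin.card_Iio] at this
    omega
  · intro hi
    have hsub : Iic i ⊆ ({k | 0 < d k} : Finset (Fin n)) := fun k hk =>
      mem_filter.2 ⟨mem_univ _, hi.trans_le (hd (mem_Iic.1 hk))⟩
    have := card_le_card hsub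
    rw [Fin.card_Iic] at this
    omega

/-- Among the sets of at most `m` indices, the first `min m N` indices, `N` being the number of
positive values, maximize the sum of an antitone sequence. -/
lemma sum_le_sum_initial_of_antitone {n m : ℕ} {d : Fin n → ℝ} (hd : Antitone d)
    {B : Finset (Fin n)} (hB : #B ≤ m) :
    ∑ i ∈ B, d i ≤ ∑ i ∈ univ.filter (fun i : Fin n => (i : ℕ) < min m #{k | 0 < d k}), d i := by
  have hpos := lt_card_filter_pos_iff hd
  have hNn : #{k | 0 < d k} ≤ n := (card_le_univ _).trans_eq (Fintype.card_fin n)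
  generalize #{k | 0 < d k} = N at hpos hNn ⊢
  have hcard : #{i : Fin n | (i : ℕ) < min m N} = min m N := by
    rw [Fin.card_filter_val_lt]
    omega
  by_cases htn : min m N < n
  · refine sum_le_sum_of_threshold (θ := max 0 (d ⟨min m N, htn⟩)) (le_max_left _ _) ?_ ?_ ?_
    · intro i hi
      have hi := (mem_filter.1 hi).2
      exact max_le ((hpos i).1 (by omega)).le (hd (Fin.le_def.2 hi.le))
    · intro i hi
      have hi : min m N ≤ i := not_lt.1 fun h => hi (mem_filter.2 ⟨mem_univ _, h⟩)
      exact le_max_of_le_right (hd (Fin.le_def.2 hi))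
    · rw [hcard]
      rcases le_or_gt m N with h | h
      · right
        omega
      · left
        refine max_eq_left (not_lt.1 fun h' => ?_)
        have := (hpos _).2 h'
        simp only at this
        omega
  · refine sum_le_sum_of_threshold le_rfl ?_ ?_ (Or.inl rfl)
    · intro i hi
      exact ((hpos i).1 (by have := (mem_filter.1 hi).2; omega)).le
    · intro i hi
      exact absurd (mem_filter.2 ⟨mem_univ _, by omega⟩) hi

/-- Proposition 4: with per-tuple weights `c j = min (c₁ j) (c₂ j)`, defender budget
`k_D` over the `2n` edges, and the attacker best-responding per tuple, the minimum
achievable total damage is `∑ j, c j` minus the sum of the `min (⌊k_D/2⌋) N_p` largest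
positive weights, achieved by protecting both edges of the corresponding tuples. -/
theorem defender_single_sample_optimal (n kD : ℕ) (c₁ c₂ : Fin n → ℝ) :
    let c : Fin n → ℝ := fun j => min (c₁ j) (c₂ j)
    let Np : ℕ := (Finset.univ.filter (fun j : Fin n => 0 < c j)).card
    let t : ℕ := min (kD / 2) Np
    let σ := Tuple.sort (fun j => -c j)
    let p : Fin n → Bool := fun j => decide ((σ.symm j : ℕ) < t)
    IsLeast {s : ℝ | ∃ p₁ p₂ : Fin n → Bool,
        (Finset.univ.filter (fun j => p₁ j = true)).card +
          (Finset.univ.filter (fun j => p₂ j = true)).card ≤ kD ∧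
        s = ∑ j, (if p₁ j then (if p₂ j then (0 : ℝ) else c₂ j)
            else (if p₂ j then c₁ j else c j))}
      (∑ j, c j - ∑ i ∈ Finset.univ.filter (fun i : Fin n => (i : ℕ) < t), c (σ i)) ∧
    (Finset.univ.filter (fun j => p j = true)).card +
      (Finset.univ.filter (fun j => p j = true)).card ≤ kD ∧
    (∑ j, (if p j then (if p j then (0 : ℝ) else c₂ j) else (if p j then c₁ j else c j))) =
      ∑ j, c j - ∑ i ∈ Finset.univ.filter (fun i : Fin n => (i : ℕ) < t), c (σ i) := by
  intro c Np t σ p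
  have hd : Antitone (c ∘ σ) := fun i j hij => by
    have := Tuple.monotone_sort (fun j => -c j) hij
    simpa using this
  have hNp : #{k | 0 < (c ∘ σ) k} = Np :=
    card_equiv σ (by simp)
  have hcard : #{j | p j = true} = #{i : Fin n | (i : ℕ) < t} :=
    card_equiv σ.symm (by simp [p])
  have hbudget : #{j | p j = true} + #{j | p j = true} ≤ kD := by
    rw [hcard, Fin.card_filter_val_lt]
    omega
  have hvalue : (∑ j, (if p j then (if p j then (0 : ℝ) else c₂ j)
      else (if p j then c₁ j else c j))) =
      ∑ j, c j - ∑ i ∈ univ.filter (fun i : Fin n => (i : ℕ) < t), c (σ i) := by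
    have hsum : ∑ i ∈ univ.filter (fun i : Fin n => (i : ℕ) < t), c (σ i) =
        ∑ j with p j = true, c j :=
      sum_equiv σ (by simp [p]) (by simp)
    rw [hsum, sum_filter, ← sum_sub_distrib]
    refine sum_congr rfl fun j _ => ?_
    by_cases hj : p j = true <;> simp [hj]
  refine ⟨⟨⟨p, p, hbudget, hvalue.symm⟩, ?_⟩, hbudget, hvalue⟩
  rintro s ⟨p₁, p₂, hk, rfl⟩
  have hcardB : #{i | p₁ (σ i) = true ∧ p₂ (σ i) = true} ≤ kD / 2 := by
    have h₀ : #{i | p₁ (σ i) = true ∧ p₂ (σ i) = true} = #{j | p₁ j = true ∧ p₂ j = true} :=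
      card_equiv σ (by simp)
    have h₁ : #{j | p₁ j = true ∧ p₂ j = true} ≤ #{j | p₁ j = true} :=
      card_le_card (monotone_filter_right _ fun _ _ h => h.1)
    have h₂ : #{j | p₁ j = true ∧ p₂ j = true} ≤ #{j | p₂ j = true} :=
      card_le_card (monotone_filter_right _ fun _ _ h => h.2)
    omega
  have hsave := sum_le_sum_initial_of_antitone hd hcardB
  rw [hNp] at hsave
  have hsum : ∑ i with p₁ (σ i) = true ∧ p₂ (σ i) = true, (c ∘ σ) i =
      ∑ j with p₁ j = true ∧ p₂ j = true, c j :=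
    sum_equiv σ (by simp) (by simp)
  rw [hsum] at hsave
  refine (sub_le_sub_left hsave _).trans ?_
  rw [sum_filter, ← sum_sub_distrib]
  refine sum_le_sum fun j _ => ?_
  by_cases h₁ : p₁ j = true <;> by_cases h₂ : p₂ j = true <;> simp [h₁, h₂, c]
end

section
/- Let G be a finite simple graph on vertex set U, let V₁ and V₂ be two additional vertices, let S ⊆ U with complement T = U \ S, and let H_S be the simple graph on U ∪ {V₁, V₂} whose edges are exactly {(u, V₂) : u ∈ S} ∪ {(u, V₁) : u ∈ T}. Then ∑ over edges (u_i, u_j) of G of the number of common neighbors of u_i and u_j in H_S equals |E(G)| − cut_G(S), where |E(G)| is the number of edges of G and cut_G(S) is the number of edges of G with exactly one endpoint in S. -/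
open Finset

/-- The graph on `U ⊕ {V₁, V₂}` (with `V₁ = Sum.inr false`, `V₂ = Sum.inr true`)
whose edges are exactly `{(u, V₂) : u ∈ S} ∪ {(u, V₁) : u ∈ U \ S}`. -/
def doubleStarGraph {U : Type*} [DecidableEq U] (S : Finset U) : SimpleGraph (U ⊕ Bool) :=
  SimpleGraph.fromRel (fun x y =>
    (∃ u ∈ S, x = Sum.inl u ∧ y = Sum.inr true) ∨
    (∃ u, u ∉ S ∧ x = Sum.inl u ∧ y = Sum.inr false))

/-- The number of edges of `G` with exactly one endpoint in `S`. -/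
def cutCount {U : Type*} [Fintype U] [DecidableEq U] (G : SimpleGraph U)
    [DecidableRel G.Adj] (S : Finset U) : ℕ :=
  (G.edgeFinset.filter (fun e => ∃ a ∈ S, ∃ b, b ∉ S ∧ e = s(a, b))).card

/-- The number of common neighbors in `H_S` of the endpoints of an edge,
as a symmetric function on `Sym2`. -/
noncomputable def cnOfEdge {U : Type*} [Fintype U] [DecidableEq U] (S : Finset U) : Sym2 U → ℕ :=
  Sym2.lift ⟨fun a b =>
    ((doubleStarGraph S).commonNeighbors (Sum.inl a) (Sum.inl b)).ncard,
    fun _ _ => congrArg Set.ncard (SimpleGraph.commonNeighbors_symm _ _ _)⟩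

theorem doubleStarGraph_adj_inl_iff {U : Type*} [DecidableEq U] (S : Finset U) (a : U)
    (z : U ⊕ Bool) : (doubleStarGraph S).Adj (Sum.inl a) z ↔ z = Sum.inr (decide (a ∈ S)) := by
  rcases z with u | _ | _ <;> simp [doubleStarGraph, SimpleGraph.fromRel_adj]

theorem cnOfEdge_mk {U : Type*} [Fintype U] [DecidableEq U] (S : Finset U) (a b : U) :
    cnOfEdge S s(a, b) = if (a ∈ S ↔ b ∈ S) then 1 else 0 := by
  have h : (doubleStarGraph S).commonNeighbors (Sum.inl a) (Sum.inl b) =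
      {Sum.inr (decide (a ∈ S))} ∩ {Sum.inr (decide (b ∈ S))} := by
    ext z
    simp [SimpleGraph.mem_commonNeighbors, doubleStarGraph_adj_inl_iff]
  change ((doubleStarGraph S).commonNeighbors (Sum.inl a) (Sum.inl b)).ncard = _
  rw [h]
  by_cases ha : a ∈ S <;> by_cases hb : b ∈ S <;> simp [ha, hb]

theorem exists_eq_mk_mem_notMem_iff {U : Type*} (S : Finset U) (a b : U) :
    (∃ x ∈ S, ∃ y, y ∉ S ∧ s(a, b) = s(x, y)) ↔ ¬(a ∈ S ↔ b ∈ S) := by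
  simp only [Sym2.eq_iff]
  grind

theorem cnOfEdge_eq_ite {U : Type*} [Fintype U] [DecidableEq U] (S : Finset U) (e : Sym2 U) :
    cnOfEdge S e = if ¬(∃ a ∈ S, ∃ b, b ∉ S ∧ e = s(a, b)) then 1 else 0 := by
  induction e with
  | _ a b => simp only [cnOfEdge_mk, exists_eq_mk_mem_notMem_iff, not_not]

/-- Counting identity of the MaxCut reduction in Theorem 1:
`∑_{(u_i,u_j) ∈ E(G)} |N_{H_S}(u_i,u_j)| = |E(G)| − cut_G(S)`. -/
theorem sum_commonNeighbors_eq_edges_sub_cut {U : Type*} [Fintype U] [DecidableEq U]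
    (G : SimpleGraph U) [DecidableRel G.Adj] (S : Finset U) :
    ∑ e ∈ G.edgeFinset, cnOfEdge S e = G.edgeFinset.card - cutCount G S := by
  simp only [cnOfEdge_eq_ite, ← card_filter]
  rw [cutCount, ← card_filter_add_card_filter_not (s := G.edgeFinset)
    (fun e => ∃ a ∈ S, ∃ b, b ∉ S ∧ e = s(a, b)), Nat.add_sub_cancel_left]
end

section
/- Let G be a finite simple graph, v₁ ≠ v₂ two vertices, and w a common neighbor of v₁ and v₂. Let G₁ be G with edge (v₁,w) deleted and G₂ be G with edge (v₂,w) deleted. Then the Sørensen similarity of v₁ and v₂ is the same in G₁ and G₂: 2·|N_{G₁}(v₁,v₂)| / (d_{G₁}(v₁) + d_{G₁}(v₂)) = 2·|N_{G₂}(v₁,v₂)| / (d_{G₂}(v₁) + d_{G₂}(v₂)), both being equal to 2·(|N_G(v₁,v₂)| − 1) / (d_G(v₁) + d_G(v₂) − 1). -/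
namespace SimpleGraph

variable {V : Type*} (G : SimpleGraph V)

theorem neighborSet_deleteEdges_singleton_left (v w : V) :
    (G.deleteEdges {s(v, w)}).neighborSet v = G.neighborSet v \ {w} := by
  ext x
  simp only [mem_neighborSet, deleteEdges_adj, Set.mem_singleton_iff, Sym2.eq_iff, Set.mem_sdiff]
  grind

theorem neighborSet_deleteEdges_singleton_of_ne {u v w : V} (huv : u ≠ v) (huw : u ≠ w) :
    (G.deleteEdges {s(v, w)}).neighborSet u = G.neighborSet u := by
  ext x
  simp [huv, huw]

theorem commonNeighbors_deleteEdges_singleton_left {u v w : V} (huv : u ≠ v) (huw : u ≠ w) :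
    (G.deleteEdges {s(v, w)}).commonNeighbors v u = G.commonNeighbors v u \ {w} := by
  rw [commonNeighbors_eq, commonNeighbors_eq, neighborSet_deleteEdges_singleton_left,
    neighborSet_deleteEdges_singleton_of_ne G huv huw, Set.sdiff_inter_right_comm]

/-- The Sørensen similarity of `v` and `u` after deleting the edge from `v` to a common
neighbor `w`. -/
theorem sorensen_deleteEdges_singleton_left [Finite V] {u v w : V} (huv : u ≠ v)
    (hw : w ∈ G.commonNeighbors v u) :
    (2 * (((G.deleteEdges {s(v, w)}).commonNeighbors v u).ncard : ℝ)) /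
        ((((G.deleteEdges {s(v, w)}).neighborSet v).ncard : ℝ) +
          (((G.deleteEdges {s(v, w)}).neighborSet u).ncard : ℝ)) =
      (2 * (((G.commonNeighbors v u).ncard : ℝ) - 1)) /
        (((G.neighborSet v).ncard : ℝ) + ((G.neighborSet u).ncard : ℝ) - 1) := by
  have huw : u ≠ w := G.ne_of_adj hw.2
  rw [commonNeighbors_deleteEdges_singleton_left G huv huw,
    neighborSet_deleteEdges_singleton_left, neighborSet_deleteEdges_singleton_of_ne G huv huw,
    ← Set.ncard_sdiff_singleton_add_one hw, ← Set.ncard_sdiff_singleton_add_one hw.1]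
  push_cast
  ring_nf

end SimpleGraph

/-- Sørensen is a symmetric local metric: deleting either edge of the tuple
`(v₁, w, v₂)` yields the same Sørensen similarity of `v₁` and `v₂`, namely
`2(|N_G(v₁,v₂)| − 1) / (d_G(v₁) + d_G(v₂) − 1)`. -/
theorem sorensen_symmetric {V : Type*} [Fintype V]
    (G : SimpleGraph V) (v₁ v₂ : V) (h : v₁ ≠ v₂)
    (w : V) (hw : w ∈ G.commonNeighbors v₁ v₂) :
    let N : SimpleGraph V → ℕ := fun H => (H.commonNeighbors v₁ v₂).ncard
    let d : SimpleGraph V → V → ℕ := fun H u => (H.neighborSet u).ncard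
    let G₁ := G.deleteEdges {s(v₁, w)}
    let G₂ := G.deleteEdges {s(v₂, w)}
    (2 * (N G₁ : ℝ)) / ((d G₁ v₁ : ℝ) + (d G₁ v₂ : ℝ)) =
      (2 * (N G₂ : ℝ)) / ((d G₂ v₁ : ℝ) + (d G₂ v₂ : ℝ)) ∧
    (2 * (N G₁ : ℝ)) / ((d G₁ v₁ : ℝ) + (d G₁ v₂ : ℝ)) =
      (2 * ((N G : ℝ) - 1)) / ((d G v₁ : ℝ) + (d G v₂ : ℝ) - 1) := by
  intro N d G₁ G₂
  have h₁ := G.sorensen_deleteEdges_singleton_left h.symm hw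
  have h₂ := G.sorensen_deleteEdges_singleton_left h (G.commonNeighbors_symm v₁ v₂ ▸ hw)
  rw [SimpleGraph.commonNeighbors_symm _ v₂ v₁, SimpleGraph.commonNeighbors_symm _ v₂ v₁,
    add_comm (((G.deleteEdges _).neighborSet v₂).ncard : ℝ),
    add_comm ((G.neighborSet v₂).ncard : ℝ)] at h₂
  exact ⟨h₁.trans h₂.symm, h₁⟩
end

section
/- Let G be a finite simple graph, v₁ ≠ v₂ two vertices, and w a common neighbor of v₁ and v₂, and assume d_G(v₁) ≥ d_G(v₂) ≥ 2. Let G₁ be G with edge (v₁,w) deleted and G₂ be G with edge (v₂,w) deleted. Then the Salton similarity of v₁ and v₂ in G₁ is at most that in G₂: (|N_G(v₁,v₂)| − 1)/√((d_G(v₁) − 1)·d_G(v₂)) ≤ (|N_G(v₁,v₂)| − 1)/√(d_G(v₁)·(d_G(v₂) − 1)); that is, to minimize the Salton similarity of the target pair, the attacker should delete the edge of the tuple (v₁, w, v₂) incident to the endpoint of larger degree. -/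
namespace SimpleGraph

variable {V : Type*} (G : SimpleGraph V)

lemma neighborSet_deleteEdges_left (a w : V) :
    (G.deleteEdges {s(a, w)}).neighborSet a = G.neighborSet a \ {w} := by
  ext x
  simpa using fun (hx : G.Adj a x) _ _ => hx.ne'

lemma neighborSet_deleteEdges_of_ne {a w u : V} (ha : u ≠ a) (hw : u ≠ w) :
    (G.deleteEdges {s(a, w)}).neighborSet u = G.neighborSet u := by
  ext x
  simp [ha, hw]

lemma commonNeighbors_deleteEdges_left {a b w : V} (ha : b ≠ a) (hw : b ≠ w) :
    (G.deleteEdges {s(a, w)}).commonNeighbors a b = G.commonNeighbors a b \ {w} := by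
  rw [commonNeighbors, neighborSet_deleteEdges_left, neighborSet_deleteEdges_of_ne G ha hw,
    commonNeighbors, Set.sdiff_inter_right_comm]

end SimpleGraph

lemma div_sqrt_sub_one_mul_le {n a b : ℝ} (hn : 0 ≤ n) (hb : 1 < b) (hab : b ≤ a) :
    n / √((a - 1) * b) ≤ n / √(a * (b - 1)) := by
  have hpos : 0 < a * (b - 1) := mul_pos (by linarith) (by linarith)
  exact div_le_div_of_nonneg_left hn (Real.sqrt_pos.2 hpos) (Real.sqrt_le_sqrt (by linarith))

/-- Salton is an asymmetric local metric: if `d_G(v₁) ≥ d_G(v₂) ≥ 2` and `w` is a common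
neighbor of `v₁` and `v₂`, then deleting the edge `(v₁, w)` (at the higher-degree
endpoint) yields a Salton similarity of `v₁` and `v₂` that is at most the one obtained
by deleting `(v₂, w)`:
`(|N| − 1)/√((d₁ − 1)·d₂) ≤ (|N| − 1)/√(d₁·(d₂ − 1))`. -/
theorem salton_asymmetric {V : Type*} [Fintype V]
    (G : SimpleGraph V) (v₁ v₂ : V) (h : v₁ ≠ v₂)
    (w : V) (hw : w ∈ G.commonNeighbors v₁ v₂)
    (hd : (G.neighborSet v₂).ncard ≤ (G.neighborSet v₁).ncard)
    (hd2 : 2 ≤ (G.neighborSet v₂).ncard) :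
    let N : SimpleGraph V → ℕ := fun H => (H.commonNeighbors v₁ v₂).ncard
    let d : SimpleGraph V → V → ℕ := fun H u => (H.neighborSet u).ncard
    let G₁ := G.deleteEdges {s(v₁, w)}
    let G₂ := G.deleteEdges {s(v₂, w)}
    (N G₁ : ℝ) / Real.sqrt ((d G₁ v₁ : ℝ) * (d G₁ v₂ : ℝ)) ≤
      (N G₂ : ℝ) / Real.sqrt ((d G₂ v₁ : ℝ) * (d G₂ v₂ : ℝ)) ∧
    ((N G : ℝ) - 1) / Real.sqrt (((d G v₁ : ℝ) - 1) * (d G v₂ : ℝ)) ≤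
      ((N G : ℝ) - 1) / Real.sqrt ((d G v₁ : ℝ) * ((d G v₂ : ℝ) - 1)) := by
  intro N d G₁ G₂
  have h₁ : G.Adj v₁ w := hw.1
  have h₂ : G.Adj v₂ w := hw.2
  have hN : 1 ≤ N G := (Set.ncard_pos (Set.toFinite _)).2 ⟨w, hw⟩
  have hN₁ : N G₁ = N G - 1 := by
    simp only [N, G₁]
    rw [G.commonNeighbors_deleteEdges_left h.symm h₂.ne, Set.ncard_sdiff_singleton_of_mem hw]
  have hN₂ : N G₂ = N G - 1 := by
    simp only [N, G₂]
    rw [SimpleGraph.commonNeighbors_symm, G.commonNeighbors_deleteEdges_left h h₁.ne,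
      SimpleGraph.commonNeighbors_symm, Set.ncard_sdiff_singleton_of_mem hw]
  have hd₁₁ : d G₁ v₁ = d G v₁ - 1 := by
    simp only [d, G₁]
    rw [G.neighborSet_deleteEdges_left, Set.ncard_sdiff_singleton_of_mem hw.1]
  have hd₁₂ : d G₁ v₂ = d G v₂ := by
    simp only [d, G₁]
    rw [G.neighborSet_deleteEdges_of_ne h.symm h₂.ne]
  have hd₂₁ : d G₂ v₁ = d G v₁ := by
    simp only [d, G₂]
    rw [G.neighborSet_deleteEdges_of_ne h h₁.ne]
  have hd₂₂ : d G₂ v₂ = d G v₂ - 1 := by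
    simp only [d, G₂]
    rw [G.neighborSet_deleteEdges_left, Set.ncard_sdiff_singleton_of_mem hw.2]
  have hle : d G v₂ ≤ d G v₁ := hd
  have htwo : 2 ≤ d G v₂ := hd2
  have key := div_sqrt_sub_one_mul_le (n := (N G : ℝ) - 1) (a := d G v₁) (b := d G v₂)
    (sub_nonneg.2 (by exact_mod_cast hN)) (by exact_mod_cast htwo) (by exact_mod_cast hle)
  refine ⟨?_, key⟩
  rw [hN₁, hN₂, hd₁₁, hd₁₂, hd₂₁, hd₂₂, Nat.cast_sub hN,
    Nat.cast_sub (by omega : 1 ≤ d G v₁), Nat.cast_sub (by omega : 1 ≤ d G v₂), Nat.cast_one]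
  exact key
end
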